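/- Let X be supported on {x_1,...,x_n} with probabilities p_1 ≥ p_2 ≥ ... ≥ p_n and let 1 ≤ k < n. The minimal expected log-loss for k guesses satisfies ME^{(k)}_1(P_X) = H(X) − H_{s*}(p_1, p_2, ..., p_{s*−1}, Σ_{i=s*}^{n} p_i) − (Σ_{i=s*}^{n} p_i)·log(k − s* + 1), where s* = min{ r ∈ {1,...,k} : (k−r+1)·p_r / Σ_{i=r}^{n} p_i ≤ 1 }, H(X) = Σ_{i=1}^{n} p_i log(1/p_i) is the Shannon entropy, and H_{s*}(q_1,...,q_{s*}) := Σ_{i=1}^{s*} q_i log(1/q_i). -/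

import Mathlib

open Finset
open scoped ENNReal

/-- A `k`-guess strategy on `Fin n` is a probability mass function on `k`-tuples. -/
def IsStrategy {n k : ℕ} (Q : (Fin k → Fin n) → ℝ) : Prop :=
  (∀ a, 0 ≤ Q a) ∧ ∑ a, Q a = 1

/-- `succProb Q x` is the probability that at least one of the `k` guesses equals `x`. -/
noncomputable def succProb {n k : ℕ} (Q : (Fin k → Fin n) → ℝ) (x : Fin n) : ℝ :=
  ∑ a ∈ Finset.univ.filter (fun a : Fin k → Fin n => ∃ j, a j = x), Q a

/-- The log-loss `ℓ_1(p) = log(1/p)`, valued in `ℝ≥0∞` (it is `+∞` at `p = 0`). -/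
noncomputable def logLoss (p : ℝ) : ℝ≥0∞ :=
  if p = 0 then ⊤ else ENNReal.ofReal (Real.log (1 / p))

lemma aux_strategy {n k : ℕ} (hk1 : 1 ≤ k) (hkn : k < n) (g : Fin n → ℝ)
    (g0 : ∀ i, 0 ≤ g i) (g1 : ∀ i, g i ≤ 1) (gs : ∑ i, g i = k) :
    ∃ Q : (Fin k → Fin n) → ℝ, IsStrategy Q ∧ ∀ x, succProb Q x = g x := by
  have hk : (0:ℝ) < k := by exact_mod_cast hk1
  have hnk : (0:ℝ) < (n:ℝ) - k := by
    have : (k:ℝ) < n := by exact_mod_cast hkn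
    linarith
  obtain ⟨d, rfl⟩ : ∃ d, n = k + d := ⟨n - k, by omega⟩
  have hd : (0:ℝ) < d := by push_cast at hnk; linarith
  let M : Matrix (Fin (k+d)) (Fin (k+d)) ℝ :=
    fun j i => if (j:ℕ) < k then g i / k else (1 - g i) / d
  have hM : M ∈ doublyStochastic ℝ (Fin (k+d)) := by
    rw [mem_doublyStochastic_iff_sum]
    refine ⟨?_, ?_, ?_⟩
    · intro j i
      simp only [M]
      split_ifs
      · exact div_nonneg (g0 i) hk.le
      · exact div_nonneg (by linarith [g1 i]) hd.le
    · intro j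
      simp only [M]
      split_ifs
      · rw [← Finset.sum_div, gs, div_self hk.ne']
      · rw [← Finset.sum_div, Finset.sum_sub_distrib, gs]
        simp [hd.ne']
    · intro i
      rw [Fin.sum_univ_add]
      simp [M]
      field_simp
      ring
  obtain ⟨w, w0, w1, hw⟩ := exists_eq_sum_perm_of_mem_doublyStochastic hM
  let f : Equiv.Perm (Fin (k+d)) → (Fin k → Fin (k+d)) := fun σ j => σ (Fin.castAdd d j)
  refine ⟨fun a => ∑ σ, if f σ = a then w σ else 0, ⟨?_, ?_⟩, ?_⟩
  · intro a
    exact Finset.sum_nonneg fun σ _ => by split_ifs; exacts [w0 σ, le_rfl]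
  · rw [Finset.sum_comm]
    simpa using w1
  · intro x
    have h1 : ∑ j : Fin k, M (Fin.castAdd d j) x = g x := by
      simp [M]
      field_simp
    rw [← h1, ← hw]
    unfold succProb
    rw [Finset.sum_comm]
    simp only [Matrix.sum_apply, Matrix.smul_apply, smul_eq_mul]
    rw [Finset.sum_comm (s := (univ : Finset (Fin k)))]
    refine Finset.sum_congr rfl fun σ _ => ?_
    rw [← Finset.mul_sum, Finset.sum_ite_eq]
    simp only [Finset.mem_filter, Finset.mem_univ, true_and, f,
      Equiv.Perm.permMatrix, PEquiv.toMatrix_apply, Equiv.toPEquiv_apply, Option.mem_some_iff]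
    split_ifs with h
    · obtain ⟨j, hj⟩ := h
      rw [Finset.sum_eq_single j]
      · simp [hj]
      · intro b _ hb
        rw [if_neg]
        intro hb'
        apply hb
        have := σ.injective (hb'.trans hj.symm)
        exact Fin.castAdd_injective _ _ this
      · simp
    · rw [Finset.sum_eq_zero, mul_zero]
      intro j _
      rw [if_neg]
      exact fun hj => h ⟨j, hj⟩

lemma aux_E {n : ℕ} (p g : Fin n → ℝ) (hp0 : ∀ i, 0 ≤ p i)
    (g0 : ∀ i, 0 ≤ g i) (g1 : ∀ i, g i ≤ 1) (hg : ∀ i, 0 < p i → 0 < g i) :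
    ∑ i, ENNReal.ofReal (p i) * logLoss (g i) =
      ENNReal.ofReal (∑ i, p i * Real.log (1 / g i)) := by
  have hl : ∀ i, 0 ≤ Real.log (1 / g i) := fun i => by
    rw [one_div, Real.log_inv]
    have := Real.log_nonpos (g0 i) (g1 i)
    linarith
  rw [ENNReal.ofReal_sum_of_nonneg fun i _ => mul_nonneg (hp0 i) (hl i)]
  refine Finset.sum_congr rfl fun i _ => ?_
  rcases (hp0 i).eq_or_lt with h | h
  · simp [← h]
  · rw [logLoss, if_neg (hg i h).ne', ENNReal.ofReal_mul (hp0 i)]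

lemma aux_g {n k : ℕ} (Q : (Fin k → Fin n) → ℝ) (hQ : IsStrategy Q) :
    (∀ i, 0 ≤ succProb Q i) ∧ (∀ i, succProb Q i ≤ 1) ∧ ∑ i, succProb Q i ≤ k := by
  refine ⟨fun i => Finset.sum_nonneg fun a _ => hQ.1 a, fun i => ?_, ?_⟩
  · rw [← hQ.2]
    exact Finset.sum_le_sum_of_subset_of_nonneg (Finset.filter_subset _ _) fun a _ _ => hQ.1 a
  · unfold succProb
    simp_rw [Finset.sum_filter]
    rw [Finset.sum_comm]
    calc _ ≤ ∑ a, (k:ℝ) * Q a := by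
          refine Finset.sum_le_sum fun a _ => ?_
          rw [← Finset.sum_filter, Finset.sum_const, nsmul_eq_mul]
          refine mul_le_mul_of_nonneg_right ?_ (hQ.1 a)
          have : (Finset.univ.filter fun x => ∃ j, a j = x) = Finset.univ.image a := by
            ext x; simp
          rw [this]
          have h := Finset.card_image_le (s := (univ : Finset (Fin k))) (f := a)
          rw [Finset.card_univ, Fintype.card_fin] at h
          exact_mod_cast h
      _ = k := by rw [← Finset.mul_sum, hQ.2, mul_one]

lemma aux_card {n t : ℕ} (h : t ≤ n) :
    (Finset.univ.filter fun i : Fin n => (i:ℕ) < t).card = t := by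
  rw [Fin.card_filter_val_lt]; omega

/-- **Corollary 1** (Minimal expected log-loss for `k` guesses).  The indices below are
1-based: `p ⟨r-1, _⟩` is `p_r` of the paper; the filter `(i : ℕ) < s - 1` ranges over the
1-based indices `i ≤ s* - 1` and the filter `s - 1 ≤ (i : ℕ)` over the indices `i ≥ s*`. -/
theorem minimal_expected_log_loss_k_guesses
    {n k : ℕ} (hk1 : 1 ≤ k) (hkn : k < n)
    (p : Fin n → ℝ) (hp0 : ∀ i, 0 ≤ p i) (hp1 : ∑ i, p i = 1)
    (hsorted : ∀ i j : Fin n, i ≤ j → p j ≤ p i)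
    (s : ℕ)
    (hs : IsLeast {r : ℕ | ∃ h : 1 ≤ r ∧ r ≤ k,
        ((k : ℝ) - r + 1) * p ⟨r - 1, by omega⟩ /
          (∑ i ∈ Finset.univ.filter (fun i : Fin n => r - 1 ≤ (i : ℕ)), p i) ≤ 1} s) :
    IsLeast {E : ℝ≥0∞ | ∃ Q : (Fin k → Fin n) → ℝ, IsStrategy Q ∧
        E = ∑ i, ENNReal.ofReal (p i) * logLoss (succProb Q i)}
      (ENNReal.ofReal (
        -- H(X)
        (∑ i, p i * Real.log (1 / p i))
        -- − H_{s*}(p_1, …, p_{s*-1}, Σ_{i ≥ s*} p_i)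
        - ((∑ i ∈ Finset.univ.filter (fun i : Fin n => (i : ℕ) < s - 1),
              p i * Real.log (1 / p i))
           + (∑ i ∈ Finset.univ.filter (fun i : Fin n => s - 1 ≤ (i : ℕ)), p i) *
              Real.log (1 / ∑ i ∈ Finset.univ.filter (fun i : Fin n => s - 1 ≤ (i : ℕ)), p i))
        -- − (Σ_{i ≥ s*} p_i) · log(k − s* + 1)
        - (∑ i ∈ Finset.univ.filter (fun i : Fin n => s - 1 ≤ (i : ℕ)), p i) *
            Real.log ((k : ℝ) - s + 1))) := by
  obtain ⟨⟨⟨hs1, hsk⟩, hmem⟩, hmin⟩ := hs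
  obtain ⟨t, rfl⟩ : ∃ t, s = t + 1 := ⟨s - 1, by omega⟩
  simp only [Nat.add_sub_cancel] at hmem ⊢
  set T : ℝ := ∑ i ∈ Finset.univ.filter (fun i : Fin n => t ≤ (i : ℕ)), p i with hT
  have hT0 : 0 ≤ T := Finset.sum_nonneg fun i _ => hp0 i
  obtain ⟨m, hm⟩ : ∃ m : ℝ, m = (k:ℝ) - t := ⟨_, rfl⟩
  have hm1 : 1 ≤ m := by
    have : ((t + 1 : ℕ) : ℝ) ≤ k := by exact_mod_cast hsk
    push_cast at this; linarith
  have hkm : (k:ℝ) - (t + 1 : ℕ) + 1 = m := by push_cast; linarith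
  rw [hkm] at hmem ⊢
  have hnot : (Finset.univ.filter fun i : Fin n => ¬ (i:ℕ) < t)
      = Finset.univ.filter fun i : Fin n => t ≤ (i:ℕ) := by
    ext i; simp
  have hsplit : ∀ f : Fin n → ℝ, ∑ i, f i =
      ∑ i ∈ Finset.univ.filter (fun i : Fin n => (i:ℕ) < t), f i
      + ∑ i ∈ Finset.univ.filter (fun i : Fin n => t ≤ (i:ℕ)), f i := by
    intro f
    rw [← hnot, Finset.sum_filter_add_sum_filter_not]
  have hpT : ∀ i : Fin n, t ≤ (i:ℕ) → p i ≤ T := fun i hi =>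
    Finset.single_le_sum (f := p) (fun i _ => hp0 i) (by simp [hi])
  set gs : Fin n → ℝ := fun i => if (i:ℕ) < t then 1 else m * p i / T with hgs
  have hV : (∑ i, p i * Real.log (1 / p i))
        - ((∑ i ∈ Finset.univ.filter (fun i : Fin n => (i : ℕ) < t),
              p i * Real.log (1 / p i)) + T * Real.log (1 / T))
        - T * Real.log m = ∑ i, p i * Real.log (1 / gs i) := by
    rw [hsplit (fun i => p i * Real.log (1 / p i)), hsplit (fun i => p i * Real.log (1 / gs i))]
    rw [Finset.sum_eq_zero (s := Finset.univ.filter (fun i : Fin n => (i : ℕ) < t))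
      (f := fun i => p i * Real.log (1 / gs i))]
    swap
    · intro i hi
      simp only [Finset.mem_filter, Finset.mem_univ, true_and] at hi
      simp [hgs, hi]
    have : ∀ i ∈ Finset.univ.filter (fun i : Fin n => t ≤ (i:ℕ)), p i * Real.log (1 / gs i)
        = p i * Real.log (1 / p i) - p i * (Real.log (1 / T) + Real.log m) := by
      intro i hi
      simp only [Finset.mem_filter, Finset.mem_univ, true_and] at hi
      rcases (hp0 i).eq_or_lt with h | h
      · simp [← h]
      · have hTp : 0 < T := h.trans_le (hpT i hi)
        simp only [hgs, not_lt.mpr hi, if_false]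
        simp only [one_div, Real.log_inv]
        rw [Real.log_div (by positivity) (by positivity),
          Real.log_mul (by positivity) (by positivity)]
        ring
    rw [Finset.sum_congr rfl this, Finset.sum_sub_distrib, ← Finset.sum_mul, ← hT]
    ring
  rw [hV]
  have hcard := aux_card (n := n) (t := t) (by omega)
  have hmpT : ∀ i : Fin n, t ≤ (i:ℕ) → 0 < T → m * p i / T ≤ 1 := by
    intro i hi hTp
    refine le_trans ?_ hmem
    have := hsorted ⟨t, by omega⟩ i hi
    gcongr
  have hgs0 : ∀ i, 0 < p i → 0 < gs i := by
    intro i hi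
    simp only [hgs]
    split_ifs with h
    · norm_num
    · have := hi.trans_le (hpT i (not_lt.mp h))
      positivity
  constructor
  · -- achievability
    obtain ⟨g, g0, g1, gsum, hgg⟩ : ∃ g : Fin n → ℝ, (∀ i, 0 ≤ g i) ∧ (∀ i, g i ≤ 1) ∧
        ∑ i, g i = k ∧ ∀ i, 0 < p i → g i = gs i := by
      rcases hT0.eq_or_lt with hTz | hTp
      · refine ⟨fun i => if (i:ℕ) < k then 1 else 0, ?_, ?_, ?_, ?_⟩
        · intro i; dsimp only; split_ifs <;> norm_num
        · intro i; dsimp only; split_ifs <;> norm_num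
        · rw [Finset.sum_ite]
          simp [aux_card hkn.le]
        · intro i hi
          have : (i:ℕ) < t := by
            by_contra h
            have := hpT i (not_lt.mp h)
            linarith
          simp only [hgs, this, if_true]
          rw [if_pos (by omega)]
      · refine ⟨gs, ?_, ?_, ?_, fun _ _ => rfl⟩
        · intro i
          simp only [hgs]
          split_ifs
          · norm_num
          · have := hp0 i
            positivity
        · intro i
          simp only [hgs]
          split_ifs with h
          · norm_num
          · exact hmpT i (not_lt.mp h) hTp
        · simp only [hgs]
          rw [Finset.sum_ite, hnot, ← Finset.sum_div, ← Finset.mul_sum, ← hT]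
          rw [Finset.sum_const, hcard, mul_div_cancel_right₀ _ hTp.ne', hm]
          simp
    obtain ⟨Q, hQ, hQg⟩ := aux_strategy hk1 hkn g g0 g1 gsum
    refine ⟨Q, hQ, ?_⟩
    simp only [hQg]
    rw [aux_E p g hp0 g0 g1 fun i hi => by rw [hgg i hi]; exact hgs0 i hi]
    congr 1
    refine Finset.sum_congr rfl fun i _ => ?_
    rcases (hp0 i).eq_or_lt with h | h
    · simp [← h]
    · rw [hgg i h]
  · -- lower bound
    rintro E ⟨Q, hQ, rfl⟩
    obtain ⟨g0, g1, gsum⟩ := aux_g Q hQ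
    set g := succProb Q with hg
    by_cases hpos : ∀ i, 0 < p i → 0 < g i
    swap
    · push Not at hpos
      obtain ⟨i, hi, hgi⟩ := hpos
      have hgi : g i = 0 := le_antisymm hgi (g0 i)
      have htop : ∑ i, ENNReal.ofReal (p i) * logLoss (g i) = ⊤ := by
        rw [ENNReal.sum_eq_top]
        refine ⟨i, Finset.mem_univ _, ?_⟩
        rw [hgi, logLoss, if_pos rfl, ENNReal.mul_top]
        simpa using hi
      rw [htop]
      exact le_top
    rw [aux_E p g hp0 g0 g1 hpos]
    apply ENNReal.ofReal_le_ofReal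
    have hm0 : 0 < m := by linarith
    set l : ℝ := T / m with hl
    have hl0 : 0 ≤ l := by positivity
    have hlm : l * m = T := div_mul_cancel₀ _ hm0.ne'
    have hpl : ∀ i : Fin n, (i:ℕ) < t → l ≤ p i := by
      intro i hi
      obtain ⟨u, rfl⟩ : ∃ u, t = u + 1 := ⟨t - 1, by omega⟩
      have hu : u < n := by omega
      have h1 : p ⟨u, hu⟩ ≤ p i := hsorted i ⟨u, hu⟩ (by rw [Fin.le_def]; simp; omega)
      refine le_trans ?_ h1
      by_contra hlt
      push Not at hlt
      have hTu : ∑ i ∈ Finset.univ.filter (fun i : Fin n => u ≤ (i : ℕ)), p i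
          = p ⟨u, hu⟩ + T := by
        have : (Finset.univ.filter fun i : Fin n => u ≤ (i:ℕ)) =
            insert ⟨u, hu⟩ (Finset.univ.filter fun i : Fin n => u + 1 ≤ (i:ℕ)) := by
          ext i; simp [Fin.ext_iff]; omega
        rw [this, Finset.sum_insert (by simp)]
      have hle : u + 1 + 1 ≤ u + 1 := hmin (by
        refine ⟨⟨by omega, by omega⟩, ?_⟩
        simp only [Nat.add_sub_cancel]
        rw [hTu]
        have hp := hp0 ⟨u, hu⟩
        apply div_le_one_of_le₀ _ (by linarith)
        have hk : (k:ℝ) - (u + 1 : ℕ) + 1 = m + 1 := by rw [hm]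
        rw [hk]
        nlinarith)
      omega
    have hterm : ∀ i, p i * Real.log (1 / gs i) ≤ p i * Real.log (1 / g i) +
        (if (i:ℕ) < t then p i * (g i - 1) else l * g i - p i) := by
      intro i
      rcases (hp0 i).eq_or_lt with h | h
      · rw [← h]
        have := mul_nonneg hl0 (g0 i)
        split_ifs <;> simp [this]
      · have hgi := hpos i h
        have hgsi := hgs0 i h
        have h3 := Real.log_le_sub_one_of_pos (div_pos hgi hgsi)
        rw [Real.log_div hgi.ne' hgsi.ne'] at h3
        have h4 := mul_le_mul_of_nonneg_left h3 h.le
        simp only [one_div, Real.log_inv]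
        have h5 : (if (i:ℕ) < t then p i * (g i - 1) else l * g i - p i)
            = p i * (g i / gs i - 1) := by
          simp only [hgs]
          split_ifs with hi
          · simp
          · have hTp : 0 < T := h.trans_le (hpT i (not_lt.mp hi))
            rw [hl]
            field_simp
        rw [h5]
        linarith
    refine (Finset.sum_le_sum fun i _ => hterm i).trans ?_
    rw [Finset.sum_add_distrib]
    have hfin : ∑ i : Fin n, (if (i:ℕ) < t then p i * (g i - 1) else l * g i - p i) ≤ 0 := by
      rw [Finset.sum_ite, hnot, Finset.sum_sub_distrib, ← hT, ← Finset.mul_sum]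
      have h6 : ∑ i ∈ Finset.univ.filter (fun i : Fin n => (i:ℕ) < t), p i * (g i - 1)
          ≤ ∑ i ∈ Finset.univ.filter (fun i : Fin n => (i:ℕ) < t), l * (g i - 1) := by
        refine Finset.sum_le_sum fun i hi => ?_
        simp only [Finset.mem_filter, Finset.mem_univ, true_and] at hi
        exact mul_le_mul_of_nonpos_right (hpl i hi) (by linarith [g1 i])
      rw [← Finset.mul_sum, Finset.sum_sub_distrib, Finset.sum_const, hcard] at h6
      rw [hsplit g] at gsum
      have h7 := mul_le_mul_of_nonneg_left gsum hl0
      have h8 : (k:ℝ) = m + t := by rw [hm]; ring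
      rw [h8] at h7
      simp only [nsmul_eq_mul, mul_one] at h6
      nlinarith
    linarith
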